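/- Let G be a finite abelian group with exponent n, let R₁, …, R_m be commutative indecomposable rings, and let R = R₁ × ⋯ × R_m. Assume that n (as an element of R) is a unit of R. Then the group ring R[G] is feebly clean if and only if the group ring R[C_n] is feebly clean. -/

import Mathlib

/-- A ring is *feebly clean* if every element can be written as `u + e₁ - e₂` with `u`
a unit and `e₁`, `e₂` orthogonal idempotents. -/
def IsFeeblyCleanRing (R : Type*) [Ring R] : Prop :=
  ∀ r : R, ∃ u e₁ e₂ : R, IsUnit u ∧ IsIdempotentElem e₁ ∧ IsIdempotentElem e₂ ∧
    e₁ * e₂ = 0 ∧ r = u + e₁ - e₂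

/-- A commutative ring is *indecomposable* if it is nonzero and its only idempotents
are `0` and `1`. -/
def IsIndecomposableRing (R : Type*) [CommRing R] : Prop :=
  Nontrivial R ∧ ∀ e : R, IsIdempotentElem e → e = 0 ∨ e = 1

def GoodIdem {A : Type*} [CommRing A] (ε : A) : Prop :=
  ε * ε = ε ∧ ∀ r : A, ∃ u v e f : A, u * v * ε = ε ∧ e * e * ε = e * ε ∧ f * f * ε = f * ε ∧
    e * f * ε = 0 ∧ r * ε = (u + e - f) * ε

theorem GoodIdem.zero {A : Type*} [CommRing A] : GoodIdem (0 : A) :=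
  ⟨by simp, fun _ => ⟨0, 0, 0, 0, by simp⟩⟩

theorem GoodIdem.sup {A : Type*} [CommRing A] {ε δ : A} (h1 : GoodIdem ε) (h2 : GoodIdem δ) :
    GoodIdem (ε + δ * (1 - ε)) := by
  obtain ⟨hε, h1⟩ := h1
  obtain ⟨hδ, h2⟩ := h2
  have key : ∀ a : A, a * ε = 0 → a * δ * (1 - ε) = 0 → a * (ε + δ * (1 - ε)) = 0 := by
    intro a h h'
    linear_combination h + h'
  refine ⟨by grind, fun r => ?_⟩
  obtain ⟨u, v, e, f, a1, a2, a3, a4, a5⟩ := h1 r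
  obtain ⟨u', v', e', f', b1, b2, b3, b4, b5⟩ := h2 r
  have p1 : ∀ x y : A, (x * ε + y * (1 - ε)) * ε = x * ε := by
    intro x y; linear_combination (x - y) * hε
  have p2 : ∀ x y : A, (x * ε + y * (1 - ε)) * (1 - ε) = y * (1 - ε) := by
    intro x y; linear_combination (y - x) * hε
  have q : ∀ x y : A, ∃ w, w * ε = x * ε ∧ w * (1 - ε) = y * (1 - ε) := fun x y => ⟨_, p1 x y, p2 x y⟩
  obtain ⟨U, hU, hU'⟩ := q u u'
  obtain ⟨V, hV, hV'⟩ := q v v'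
  obtain ⟨E, hE, hE'⟩ := q e e'
  obtain ⟨F, hF, hF'⟩ := q f f'
  refine ⟨U, V, E, F, ?_, ?_, ?_, ?_, ?_⟩
  · rw [← sub_eq_zero]
    have := key (U * V - 1) (by linear_combination V * hU + u * hV + a1)
      (by linear_combination V * δ * hU' + u' * δ * hV' + (1 - ε) * b1)
    linear_combination this
  · have := key (E * E - E) (by linear_combination (E + e - 1) * hE + a2)
      (by linear_combination (E + e' - 1) * δ * hE' + (1 - ε) * b2)
    linear_combination this
  · have := key (F * F - F) (by linear_combination (F + f - 1) * hF + a3)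
      (by linear_combination (F + f' - 1) * δ * hF' + (1 - ε) * b3)
    linear_combination this
  · exact key (E * F) (by linear_combination F * hE + e * hF + a4)
      (by linear_combination F * δ * hE' + e' * δ * hF' + (1 - ε) * b4)
  · have := key (r - (U + E - F)) (by linear_combination a5 - hU - hE + hF)
      (by linear_combination (1 - ε) * b5 - δ * hU' - δ * hE' + δ * hF')
    linear_combination this

theorem GoodIdem.one_sub_prod {A ι : Type*} [CommRing A] (s : Finset ι) (ε : ι → A)
    (h : ∀ i ∈ s, GoodIdem (ε i)) : GoodIdem (1 - ∏ i ∈ s, (1 - ε i)) := by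
  classical
  induction s using Finset.induction_on with
  | empty => simpa using GoodIdem.zero
  | insert a s ha ih =>
    have := (h a (by simp)).sup (ih fun i hi => h i (by simp [hi]))
    rw [Finset.prod_insert ha]
    convert this using 1
    ring

theorem feebly_of_good {A ι : Type*} [CommRing A] [Finite ι] (ε : ι → A)
    (h : ∀ i, GoodIdem (ε i)) (hs : Ideal.span (Set.range ε) = ⊤) : IsFeeblyCleanRing A := by
  cases nonempty_fintype ι
  have hP : ∏ i, (1 - ε i) = 0 := by
    have : Ideal.span (Set.range ε) ≤ LinearMap.ker (LinearMap.mulLeft A (∏ i, (1 - ε i))) := by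
      rw [Ideal.span_le]
      rintro _ ⟨i, rfl⟩
      have h0 : (1 - ε i) * ε i = 0 := by linear_combination -(h i).1
      obtain ⟨c, hc⟩ := Finset.dvd_prod_of_mem (fun i => 1 - ε i) (Finset.mem_univ i)
      simp only [SetLike.mem_coe, LinearMap.mem_ker, LinearMap.mulLeft_apply]
      rw [hc]
      linear_combination c * h0
    have h1 := this (hs ▸ Submodule.mem_top : (1 : A) ∈ _)
    simpa using h1
  have := GoodIdem.one_sub_prod Finset.univ ε (fun i _ => h i)
  rw [hP, sub_zero] at this
  intro r
  obtain ⟨u, v, e, f, a1, a2, a3, a4, a5⟩ := this.2 r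
  simp only [mul_one] at *
  exact ⟨u, e, f, IsUnit.of_mul_eq_one v a1, a2, a3, a4, a5⟩

theorem feebly_of_surj {A B : Type*} [CommRing A] [CommRing B] (f : A →+* B)
    (hf : Function.Surjective f) (h : IsFeeblyCleanRing A) : IsFeeblyCleanRing B := by
  intro r
  obtain ⟨a, rfl⟩ := hf r
  obtain ⟨u, e, g, hu, he, hg, h0, rfl⟩ := h a
  refine ⟨f u, f e, f g, hu.map f, he.map f, hg.map f, ?_, by simp⟩
  rw [← map_mul, h0, map_zero]

theorem good_of_hom {A B : Type*} [CommRing A] [CommRing B] (f : A →+* B) (ε : B) (hε : ε * ε = ε)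
    (hf : ∀ r : B, ∃ a : A, r * ε = f a * ε) (h : IsFeeblyCleanRing A) : GoodIdem ε := by
  refine ⟨hε, fun r => ?_⟩
  obtain ⟨a, ha⟩ := hf r
  obtain ⟨u, e, g, hu, he, hg, h0, rfl⟩ := h a
  obtain ⟨v, hv⟩ := hu.exists_right_inv
  refine ⟨f u, f v, f e, f g, ?_, ?_, ?_, ?_, by simpa using ha⟩
  · rw [← map_mul, hv, map_one, one_mul]
  · rw [← map_mul, he.eq]
  · rw [← map_mul, hg.eq]
  · rw [← map_mul, h0, map_zero, zero_mul]

theorem exists_surj (G : Type*) [CommGroup G] [Finite G] :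
    ∃ f : G →* Multiplicative (ZMod (Monoid.exponent G)), Function.Surjective f := by
  have hpos : Monoid.exponent G ≠ 0 := Monoid.exponent_ne_zero_of_finite
  have : NeZero (Monoid.exponent G) := ⟨hpos⟩
  obtain ⟨φ⟩ := CommGroup.monoidHom_mulEquiv_of_hasEnoughRootsOfUnity G ℂ
  obtain ⟨g, hg⟩ := Monoid.exists_orderOf_eq_exponent (Monoid.ExponentExists.of_finite (G := G))
  set χ := φ.symm g
  have hχ : orderOf χ = Monoid.exponent G := by rw [← hg]; exact φ.symm.orderOf_eq g
  have hfin : Finite χ.range := Finite.of_surjective _ χ.rangeRestrict_surjective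
  have hcy : IsCyclic χ.range := isCyclic_subgroup_units _
  have hc : Nat.card χ.range = Monoid.exponent G := by
    rw [← IsCyclic.exponent_eq_card]
    apply Nat.dvd_antisymm
    · apply Monoid.exponent_dvd_of_forall_pow_eq_one
      rintro ⟨_, x, rfl⟩
      ext
      simp [← map_pow, Monoid.pow_exponent_eq_one]
    · rw [← hχ]
      apply orderOf_dvd_of_pow_eq_one
      ext x
      have := Monoid.pow_exponent_eq_one (⟨χ x, x, rfl⟩ : χ.range)
      have := congrArg (fun y : χ.range => ((y : ℂˣ) : ℂ)) this
      simpa using this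
  have e : χ.range ≃* Multiplicative (ZMod (Monoid.exponent G)) :=
    mulEquivOfCyclicCardEq (by rw [hc]; simp)
  exact ⟨e.toMonoidHom.comp χ.rangeRestrict, e.surjective.comp χ.rangeRestrict_surjective⟩

theorem main_general (S : Type*) [CommRing S] (G : Type*) [CommGroup G] [Finite G]
    (hu : IsUnit (Monoid.exponent G : S))
    (h : IsFeeblyCleanRing (MonoidAlgebra S (Multiplicative (ZMod (Monoid.exponent G))))) :
    IsFeeblyCleanRing (MonoidAlgebra S G) := by
  classical
  have hH : ∀ H : Subgroup G, ∃ c : S, c * (Nat.card H : S) = 1 := by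
    intro H
    have h1 : Nat.card H ∣ Monoid.exponent G ^ Group.rank G :=
      (Subgroup.card_subgroup_dvd_card H).trans (_root_.card_dvd_exponent_pow_rank G)
    have h2 : IsUnit (Nat.card H : S) := by
      refine isUnit_of_dvd_unit (Nat.cast_dvd_cast h1) ?_
      rw [Nat.cast_pow]
      exact hu.pow _
    exact h2.exists_left_inv
  choose c hc using hH
  have (H : Subgroup G) : Fintype H := Fintype.ofFinite H
  let ε : Subgroup G → MonoidAlgebra S G := fun H =>
    algebraMap S _ (c H) * ∑ x : H, MonoidAlgebra.of S G x
  have hmul : ∀ (H : Subgroup G) (x : H), MonoidAlgebra.of S G x * ε H = ε H := by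
    intro H x
    simp only [ε]
    rw [mul_left_comm, Finset.mul_sum]
    congr 1
    refine Fintype.sum_equiv (Equiv.mulLeft x) _ _ fun y => ?_
    simp [MonoidAlgebra.single_mul_single]
  have hmap : ∀ (H : Subgroup G) {B : Type _} [CommRing B] (f : MonoidAlgebra S G →+* B) (b : B),
      (∀ x : H, f (MonoidAlgebra.of S G x) * b = b) → f (ε H) * b = b := by
    intro H B _ f b hb
    simp only [ε]
    rw [map_mul, map_sum, mul_assoc, Finset.sum_mul, Finset.sum_congr rfl (fun x _ => hb x)]
    rw [Finset.sum_const, Finset.card_univ, ← Nat.card_eq_fintype_card, nsmul_eq_mul, ← mul_assoc]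
    have := congrArg f (congrArg (algebraMap S (MonoidAlgebra S G)) (hc H))
    simp only [map_mul, map_natCast, map_one] at this
    rw [this, one_mul]
  apply feebly_of_good (fun H : {H : Subgroup G // IsCyclic (G ⧸ H)} => ε H)
  · rintro ⟨H, hcyc⟩
    obtain ⟨q, hq⟩ := hcyc.exists_generator
    obtain ⟨g, rfl⟩ := QuotientGroup.mk_surjective q
    let φ : Multiplicative (ZMod (Monoid.exponent G)) →* G :=
      AddMonoidHom.toMultiplicativeLeft (ZMod.lift (Monoid.exponent G)
        ⟨zmultiplesHom (Additive G) (Additive.ofMul g), by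
          simp [← ofMul_pow, Monoid.pow_exponent_eq_one]⟩)
    have hφ : ∀ k : ℤ, φ (Multiplicative.ofAdd (k : ZMod (Monoid.exponent G))) = g ^ k := by
      intro k
      simp [φ]
    refine good_of_hom (MonoidAlgebra.mapDomainRingHom S φ) (ε H) ?_ ?_ h
    · exact hmap H (RingHom.id _) (ε H) (hmul H)
    · intro r
      induction r using MonoidAlgebra.induction_on with
      | of x =>
        obtain ⟨k, hk⟩ := hq (x : G ⧸ H)
        have hk' : (g ^ k)⁻¹ * x ∈ H := by
          rw [← QuotientGroup.eq]; simpa using hk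
        refine ⟨MonoidAlgebra.of S _ (Multiplicative.ofAdd (k : ZMod (Monoid.exponent G))), ?_⟩
        have hx : x = g ^ k * ((g ^ k)⁻¹ * x) := by group
        have h3 := hmul H ⟨_, hk'⟩
        have h4 : (MonoidAlgebra.mapDomainRingHom S φ) (MonoidAlgebra.of S _ (Multiplicative.ofAdd (k : ZMod (Monoid.exponent G)))) = MonoidAlgebra.of S G (g ^ k) := by
          simp [hφ]
        rw [h4]
        conv_lhs => rw [hx, map_mul, mul_assoc]
        rw [h3]
      | add a b ha hb =>
        obtain ⟨a', ha⟩ := ha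
        obtain ⟨b', hb⟩ := hb
        exact ⟨a' + b', by rw [map_add, add_mul, add_mul, ha, hb]⟩
      | smul s a ha =>
        obtain ⟨a', ha⟩ := ha
        refine ⟨algebraMap S _ s * a', ?_⟩
        rw [Algebra.smul_def, map_mul, mul_assoc, mul_assoc, ha]
        congr 1
        simp [MonoidAlgebra.mapDomainRingHom]
  · by_contra hne
    obtain ⟨M, hM, hle⟩ := Ideal.exists_le_maximal _ hne
    let : Field (MonoidAlgebra S G ⧸ M) := Ideal.Quotient.field M
    let f := Ideal.Quotient.mk M
    let χ : G →* (MonoidAlgebra S G ⧸ M) := (f : _ →* _).comp (MonoidAlgebra.of S G)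
    have hcyc : IsCyclic (G ⧸ χ.toHomUnits.ker) := by
      have hfin : Finite χ.toHomUnits.range :=
        Finite.of_surjective _ χ.toHomUnits.rangeRestrict_surjective
      have : IsCyclic χ.toHomUnits.range := isCyclic_subgroup_units _
      exact isCyclic_of_surjective _ (QuotientGroup.quotientKerEquivRange χ.toHomUnits).symm.surjective
    have h1 : f (ε χ.toHomUnits.ker) * 1 = 1 := by
      apply hmap
      rintro ⟨x, hx⟩
      rw [MonoidHom.mem_ker] at hx
      have := congrArg Units.val hx
      simpa [χ] using this
    have h2 : f (ε χ.toHomUnits.ker) = 0 :=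
      Ideal.Quotient.eq_zero_iff_mem.2 (hle (Ideal.subset_span ⟨⟨_, hcyc⟩, rfl⟩))
    rw [h2, zero_mul] at h1
    exact zero_ne_one h1

/-- If `R = R₁ × ⋯ × R_m` is a finite product of commutative indecomposable rings, `G` is a
finite abelian group with exponent `n`, and `n` is a unit of `R`, then the group ring `R[G]`
is feebly clean iff the group ring `R[Cₙ]` is feebly clean. -/
theorem feeblyClean_monoidAlgebra_iff_feeblyClean_monoidAlgebra_cyclic
    (m : ℕ) (R : Fin m → Type*) [∀ i, CommRing (R i)]
    (hind : ∀ i, IsIndecomposableRing (R i))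
    (G : Type*) [CommGroup G] [Fintype G]
    (n : ℕ) (hn : Monoid.exponent G = n)
    (hu : IsUnit (n : ∀ i, R i)) :
    IsFeeblyCleanRing (MonoidAlgebra (∀ i, R i) G) ↔
      IsFeeblyCleanRing (MonoidAlgebra (∀ i, R i) (Multiplicative (ZMod n))) := by
  subst hn
  constructor
  · intro h
    obtain ⟨f, hf⟩ := exists_surj G
    refine feebly_of_surj (MonoidAlgebra.mapDomainRingHom _ f) ?_ h
    intro r
    induction r using MonoidAlgebra.induction_on with
    | of x =>
      obtain ⟨y, rfl⟩ := hf x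
      exact ⟨MonoidAlgebra.of _ _ y, by simp⟩
    | add a b ha hb =>
      obtain ⟨a, rfl⟩ := ha
      obtain ⟨b, rfl⟩ := hb
      exact ⟨a + b, map_add _ _ _⟩
    | smul s a ha =>
      obtain ⟨a, rfl⟩ := ha
      refine ⟨algebraMap _ _ s * a, ?_⟩
      rw [Algebra.smul_def, map_mul]
      congr 1
      simp [MonoidAlgebra.mapDomainRingHom]
  · exact main_general _ G hu
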